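/- Let B and C be |V|×|E| and |E|×|V| matrices (with |E| = |V|) such that B = −Rᵀ + E_B and C = −R + E_C where R is the unoriented incidence matrix of a graph τ with |V| vertices and |V| edges and the error matrices have entries o(λ^{−1/2}). Then det(C) = ±det(R) + o(λ^{−1/2}) and det(B) = ±det(R) + o(λ^{−1/2}); in particular det(C) = ±2^{κ(τ)} + o(λ^{−1/2}) if τ is an odd saturated forest with κ(τ) components, and det(C) = o(λ^{−1/2}) otherwise. -/

import Mathlib

/-- A finite multigraph: loops and multiple edges are allowed.  Each edge `e`
has two (possibly equal) endpoints `fst e` and `snd e`. -/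
structure Multigraph where
  V : Type
  E : Type
  [fintV : Fintype V]
  [fintE : Fintype E]
  [decV : DecidableEq V]
  fst : E → V
  snd : E → V

attribute [instance] Multigraph.fintV Multigraph.fintE Multigraph.decV

namespace Multigraph

/-- The unoriented incidence matrix: entry `1` for an incidence of a non-loop
edge, `2` for a loop at the vertex, `0` otherwise. -/
def inc (G : Multigraph) : Matrix G.V G.E ℚ := fun v e =>
  (if G.fst e = v then 1 else 0) + (if G.snd e = v then 1 else 0)

/-- A cycle of length `l ≥ 1` in a multigraph: distinct vertices `c 0, …, c (l-1)`
and distinct edges `f 0, …, f (l-1)`, edge `f i` joining `c i` and `c (i+1)`.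
A loop is a cycle of length `1`, two parallel edges form a cycle of length `2`. -/
def IsCycle (G : Multigraph) (l : ℕ) (c : ZMod l → G.V) (f : ZMod l → G.E) : Prop :=
  0 < l ∧ Function.Injective c ∧ Function.Injective f ∧
    ∀ i, (G.fst (f i) = c i ∧ G.snd (f i) = c (i + 1)) ∨
      (G.fst (f i) = c (i + 1) ∧ G.snd (f i) = c i)

/-- Adjacency via some edge. -/
def Adj (G : Multigraph) (u v : G.V) : Prop :=
  ∃ e, (G.fst e = u ∧ G.snd e = v) ∨ (G.fst e = v ∧ G.snd e = u)

/-- The setoid of connected components. -/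
def compSetoid (G : Multigraph) : Setoid G.V :=
  ⟨Relation.EqvGen G.Adj, Relation.EqvGen.is_equivalence _⟩

/-- The connected components of `G`. -/
def Comp (G : Multigraph) : Type := Quotient G.compSetoid

/-- Number of connected components. -/
noncomputable def numComp (G : Multigraph) : ℕ := Nat.card G.Comp

/-- `G` is a saturated forest iff every connected component has equally many
vertices and edges (equivalently: every component contains exactly one cycle). -/
def IsSaturatedForest (G : Multigraph) : Prop :=
  ∀ K : G.Comp,
    Nat.card {v : G.V // Quotient.mk G.compSetoid v = K} =
      Nat.card {e : G.E // Quotient.mk G.compSetoid (G.fst e) = K}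

/-- `G` contains no even cycle. -/
def NoEvenCycle (G : Multigraph) : Prop :=
  ∀ l c f, G.IsCycle l c f → Odd l

/-- An odd saturated forest: every component contains exactly one cycle and all
cycles are odd. -/
def IsOddSaturatedForest (G : Multigraph) : Prop :=
  G.IsSaturatedForest ∧ G.NoEvenCycle

end Multigraph

namespace Multigraph

/-- The real unoriented incidence matrix. -/
def incR (G : Multigraph) : Matrix G.V G.E ℝ := fun v e =>
  (if G.fst e = v then 1 else 0) + (if G.snd e = v then 1 else 0)

end Multigraph

open Matrix Multigraph Filter Asymptotics Real

theorem Matrix.natAbs_det_eq_index_range {n : Type*} [Fintype n] [DecidableEq n]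
    (A : Matrix n n ℤ) (hA : A.det ≠ 0) :
    A.det.natAbs = (LinearMap.range A.mulVecLin).toAddSubgroup.index := by
  have hinj : Function.Injective A.mulVecLin := by
    rw [← LinearMap.ker_eq_bot, LinearMap.ker_eq_bot']
    intro x hx
    by_contra hne
    exact hA (Matrix.exists_mulVec_eq_zero_iff.1 ⟨x, hne, hx⟩)
  have h := Submodule.natAbs_det_equiv (LinearMap.range A.mulVecLin)
    (LinearEquiv.ofInjective A.mulVecLin hinj)
  have hdet : (LinearMap.range A.mulVecLin).subtype ∘ₗ
      AddMonoidHom.toIntLinearMap ((LinearEquiv.ofInjective A.mulVecLin hinj : _ ≃ₗ[ℤ] _) :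
        (n → ℤ) →+ LinearMap.range A.mulVecLin) = Matrix.toLin' A := by
    ext; rfl
  rw [hdet, LinearMap.det_toLin'] at h
  exact h

theorem Asymptotics.IsLittleO.finset_prod_sub {α ι : Type*} {l : Filter α} {g : α → ℝ}
    (hg : g =O[l] fun _ => (1 : ℝ)) (s : Finset ι) (a : ι → ℝ) (f : ι → α → ℝ)
    (h : ∀ i, (fun k => f i k - a i) =o[l] g) :
    (fun k => ∏ i ∈ s, f i k - ∏ i ∈ s, a i) =o[l] g := by
  classical
  induction s using Finset.induction_on with
  | empty => simp
  | insert i s hi ih =>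
    have hbdd : (fun k => f i k) =O[l] fun _ => (1 : ℝ) := by
      have := ((h i).isBigO.trans hg).add (isBigO_const_const (a i) one_ne_zero l)
      simpa using this
    have h1 : (fun k => f i k * (∏ j ∈ s, f j k - ∏ j ∈ s, a j)) =o[l] g := by
      simpa using hbdd.mul_isLittleO ih
    have h2 : (fun k => (∏ j ∈ s, a j) * (f i k - a i)) =o[l] g := (h i).const_mul_left _
    refine (h1.add h2).congr_left fun k => ?_
    rw [Finset.prod_insert hi, Finset.prod_insert hi]
    ring

theorem Asymptotics.IsLittleO.det_sub {α n : Type*} [Fintype n] [DecidableEq n] {l : Filter α}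
    {g : α → ℝ} (hg : g =O[l] fun _ => (1 : ℝ)) (A : Matrix n n ℝ) (M : α → Matrix n n ℝ)
    (h : ∀ i j, (fun k => M k i j - A i j) =o[l] g) :
    (fun k => (M k).det - A.det) =o[l] g := by
  simp only [Matrix.det_apply', ← Finset.sum_sub_distrib, ← mul_sub]
  refine IsLittleO.fun_sum fun τ _ => IsLittleO.const_mul_left ?_ _
  exact IsLittleO.finset_prod_sub hg _ _ (fun i k => M k (τ i) i) fun i => h (τ i) i

theorem isBigO_inv_sqrt_one {Λ : ℕ → ℝ}
    (hΛ : (fun k => Λ k - (2 * (k : ℝ) + 1) ^ 2 * π ^ 2) =O[atTop] fun _ => (1 : ℝ)) :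
    (fun k => (√(Λ k))⁻¹) =O[atTop] fun _ => (1 : ℝ) := by
  obtain ⟨c, hc⟩ := hΛ.bound
  refine IsBigO.of_bound 1 ?_
  filter_upwards [hc, eventually_ge_atTop ⌈c⌉₊] with k hk hck
  have hck' : c ≤ k := (Nat.le_ceil c).trans (by exact_mod_cast hck)
  have hΛ1 : 1 ≤ Λ k := by
    have h1 := (abs_le.1 (by simpa using hk)).1
    have hπ : 1 ≤ π ^ 2 := one_le_pow₀ (by linarith [Real.pi_gt_three])
    have hk0 : (0 : ℝ) ≤ k := k.cast_nonneg
    nlinarith [mul_le_mul_of_nonneg_left hπ (sq_nonneg (2 * (k : ℝ) + 1))]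
  have : 1 ≤ √(Λ k) := Real.one_le_sqrt.2 hΛ1
  simpa [abs_of_nonneg (Real.sqrt_nonneg (Λ k))] using inv_le_one_of_one_le₀ this

namespace Multigraph

/-- The integral incidence matrix of a graph with `|V| = |E|`, made square by a bijection. -/
def squareInc (G : Multigraph) (σ : G.V ≃ G.E) : Matrix G.V G.V ℤ := fun u v =>
  (if G.fst (σ v) = u then 1 else 0) + (if G.snd (σ v) = u then 1 else 0)

/-- The connected component of a vertex. -/
def comp (G : Multigraph) (v : G.V) : G.Comp := Quotient.mk G.compSetoid v

/-- The set of endpoints of an edge. -/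
def ends (G : Multigraph) (e : G.E) : Finset G.V := {G.fst e, G.snd e}

instance (G : Multigraph) : Finite G.Comp := inferInstanceAs (Finite (Quotient G.compSetoid))

variable {G : Multigraph}

theorem comp_fst_eq_comp_snd (e : G.E) : G.comp (G.fst e) = G.comp (G.snd e) :=
  Quotient.sound (Relation.EqvGen.rel _ _ ⟨e, Or.inl ⟨rfl, rfl⟩⟩)

theorem comp_out (K : G.Comp) : G.comp (Quotient.out K) = K := Quotient.out_eq K

theorem rel_of_comp_eq {r : G.V → G.V → Prop} (hr : Equivalence r)
    (he : ∀ e, r (G.fst e) (G.snd e)) {u v : G.V} (h : G.comp u = G.comp v) : r u v := by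
  have h' : Relation.EqvGen G.Adj u v := Quotient.exact h
  induction h' with
  | rel x y hxy =>
    obtain ⟨e, ⟨rfl, rfl⟩ | ⟨rfl, rfl⟩⟩ := hxy
    · exact he e
    · exact hr.symm (he e)
  | refl x => exact hr.refl x
  | symm x y _ ih => exact hr.symm (ih h.symm)
  | trans x y z hxy _ ih₁ ih₂ =>
    have hxy' : G.comp x = G.comp y := Quotient.sound hxy
    exact hr.trans (ih₁ hxy') (ih₂ (hxy'.symm.trans h))

theorem vecMul_squareInc (σ : G.V ≃ G.E) (y : G.V → ℤ) (v : G.V) :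
    (y ᵥ* G.squareInc σ) v = y (G.fst (σ v)) + y (G.snd (σ v)) := by
  simp [Matrix.vecMul, dotProduct, squareInc, mul_add, Finset.sum_add_distrib]

theorem squareInc_mulVec_single (σ : G.V ≃ G.E) (v : G.V) :
    G.squareInc σ *ᵥ Pi.single v 1 =
      Pi.single (G.fst (σ v)) 1 + Pi.single (G.snd (σ v)) 1 := by
  ext u
  simp [squareInc, Pi.single_apply, eq_comm]

theorem squareInc_map_intCast (σ : G.V ≃ G.E) :
    (G.squareInc σ).map (Int.cast : ℤ → ℝ) = Matrix.of fun u v => G.incR u (σ v) := by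
  ext u v
  simp [squareInc, incR]

theorem isSaturatedForest_of_det_ne_zero (σ : G.V ≃ G.E) (h : (G.squareInc σ).det ≠ 0) :
    G.IsSaturatedForest := by
  intro K
  rw [Matrix.det_apply'] at h
  obtain ⟨τ, -, hτ⟩ := Finset.exists_ne_zero_of_sum_ne_zero h
  have hinc : ∀ i, G.comp (τ i) = G.comp (G.fst (σ i)) := by
    intro i
    have hi : G.squareInc σ (τ i) i ≠ 0 :=
      Finset.prod_ne_zero_iff.1 (right_ne_zero_of_mul hτ) i (Finset.mem_univ i)
    by_cases h1 : G.fst (σ i) = τ i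
    · rw [h1]
    by_cases h2 : G.snd (σ i) = τ i
    · rw [comp_fst_eq_comp_snd, h2]
    · simp [squareInc, h1, h2] at hi
  refine Nat.card_congr ((τ.symm.trans σ).subtypeEquiv fun v => ?_)
  have := hinc (τ.symm v)
  rw [Equiv.apply_symm_apply] at this
  change G.comp v = K ↔ G.comp (G.fst (σ (τ.symm v))) = K
  rw [this]

theorem exists_alternating_zmod {l : ℕ} (hl : Even l) :
    ∃ s : ZMod l → ℤ, (∀ i, s (i + 1) = -s i) ∧ ∀ i, s i ≠ 0 := by
  let φ := ZMod.castHom hl.two_dvd (ZMod 2)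
  refine ⟨fun i => if φ i = 0 then 1 else -1, fun i => ?_, fun i => ?_⟩
  · have h : ∀ z : ZMod 2, (if z + 1 = 0 then (1 : ℤ) else -1) = -(if z = 0 then 1 else -1) := by
      decide
    simpa using h (φ i)
  · dsimp only
    split_ifs <;> simp

theorem noEvenCycle_of_det_ne_zero (σ : G.V ≃ G.E) (h : (G.squareInc σ).det ≠ 0) :
    G.NoEvenCycle := by
  rintro l c f ⟨hl, hc, hf, hcf⟩
  by_contra hodd
  have : NeZero l := ⟨hl.ne'⟩
  obtain ⟨s, hs, hs0⟩ := exists_alternating_zmod (Nat.not_odd_iff_even.1 hodd)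
  let x : G.V → ℤ := ∑ i, s i • Pi.single (σ.symm (f i)) 1
  refine h (Matrix.exists_mulVec_eq_zero_iff.1 ⟨x, fun hx => hs0 0 ?_, ?_⟩)
  · have hinj : ∀ i, σ.symm (f 0) = σ.symm (f i) ↔ 0 = i := fun i => by
      rw [σ.symm.injective.eq_iff, hf.eq_iff]
    have := congrFun hx (σ.symm (f 0))
    simpa [x, Finset.sum_apply, Pi.single_apply, hf.eq_iff] using this
  · have hterm : ∀ i, G.squareInc σ *ᵥ (s i • Pi.single (σ.symm (f i)) 1) =
        s i • Pi.single (c i) 1 - s (i + 1) • Pi.single (c (i + 1)) 1 := by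
      intro i
      rw [Matrix.mulVec_smul, squareInc_mulVec_single, Equiv.apply_symm_apply, hs]
      obtain ⟨h1, h2⟩ | ⟨h1, h2⟩ := hcf i <;> rw [h1, h2] <;> module
    simp only [x, Matrix.mulVec_sum, hterm, Finset.sum_sub_distrib]
    rw [sub_eq_zero]
    exact (Equiv.sum_comp (Equiv.addRight (1 : ZMod l))
      fun i => s i • (Pi.single (c i) 1 : G.V → ℤ)).symm

theorem exists_isCycle_of_card_biUnion_ends_le (S : Finset G.E) (hS : S.Nonempty)
    (hcard : (S.biUnion G.ends).card ≤ S.card) :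
    ∃ l c f, G.IsCycle l c f ∧ ∀ i, f i ∈ S := by
  classical
  induction S using Finset.strongInduction with
  | H S ih =>
  by_cases hmin : ∃ T ⊂ S, T.Nonempty ∧ (T.biUnion G.ends).card ≤ T.card
  · obtain ⟨T, hTS, hT, hTcard⟩ := hmin
    obtain ⟨l, c, f, hcyc, hf⟩ := ih T hTS hT hTcard
    exact ⟨l, c, f, hcyc, fun i => hTS.1 (hf i)⟩
  push Not at hmin
  have hS_le : S.card ≤ (S.biUnion G.ends).card := by
    obtain ⟨e, he⟩ := hS
    have hmono : ((S.erase e).biUnion G.ends).card ≤ (S.biUnion G.ends).card :=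
      Finset.card_le_card (Finset.biUnion_subset_biUnion_of_subset_left _ (S.erase_subset e))
    have hcard_erase := Finset.card_erase_add_one he
    obtain h0 | h0 := (S.erase e).eq_empty_or_nonempty
    · rw [h0, Finset.card_empty] at hcard_erase
      have : 0 < (S.biUnion G.ends).card :=
        Finset.card_pos.2 ⟨G.fst e, Finset.mem_biUnion.2 ⟨e, he, by simp [ends]⟩⟩
      omega
    · have := hmin _ (Finset.erase_ssubset he) h0
      omega
  have hHall : ∀ T : Finset S, T.card ≤ (T.biUnion fun e => G.ends e).card := by
    intro T
    have hT : T.biUnion (fun e => G.ends e) =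
        (T.map (Function.Embedding.subtype _)).biUnion G.ends := by
      ext; simp
    rw [hT, ← Finset.card_map (Function.Embedding.subtype _)]
    have hsub : T.map (Function.Embedding.subtype _) ⊆ S := by
      intro e he
      obtain ⟨e', -, rfl⟩ := Finset.mem_map.1 he
      exact e'.2
    obtain heq | hss := hsub.eq_or_ssubset
    · rw [heq]; exact hS_le
    · obtain h0 | h0 := (T.map (Function.Embedding.subtype _)).eq_empty_or_nonempty
      · simp [h0]
      · exact (hmin _ hss h0).le
  obtain ⟨ψ, hψ, hψe⟩ := (Finset.all_card_le_biUnion_card_iff_exists_injective _).1 hHall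
  have himage : Finset.univ.image ψ = S.biUnion G.ends := by
    refine Finset.eq_of_subset_of_card_le ?_ ?_
    · intro v hv
      obtain ⟨e, -, rfl⟩ := Finset.mem_image.1 hv
      exact Finset.mem_biUnion.2 ⟨e, e.2, hψe e⟩
    · rw [Finset.card_image_of_injective _ hψ]
      simpa using hcard
  have hsurj : ∀ e : S, ∀ v ∈ G.ends e, ∃ e', ψ e' = v := by
    intro e v hv
    have : v ∈ Finset.univ.image ψ := himage ▸ Finset.mem_biUnion.2 ⟨e, e.2, hv⟩
    simpa using this
  have hnext : ∀ e : S, ∃ e' : S, (G.fst e = ψ e ∧ G.snd e = ψ e') ∨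
      (G.fst e = ψ e' ∧ G.snd e = ψ e) := by
    intro e
    have he := hψe e
    simp only [ends, Finset.mem_insert, Finset.mem_singleton] at he
    obtain he | he := he
    · obtain ⟨e', he'⟩ := hsurj e (G.snd e) (by simp [ends])
      exact ⟨e', Or.inl ⟨he.symm, he'.symm⟩⟩
    · obtain ⟨e', he'⟩ := hsurj e (G.fst e) (by simp [ends])
      exact ⟨e', Or.inr ⟨he'.symm, he.symm⟩⟩
  choose next hnext using hnext
  obtain ⟨e₀, he₀⟩ : ∃ e₀, e₀ ∈ Function.periodicPts next := by
    obtain ⟨e, he⟩ := hS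
    obtain ⟨m, n, hmn, heq⟩ := Finite.exists_ne_map_eq_of_infinite
      fun m : ℕ => next^[m] ⟨e, he⟩
    wlog hlt : m < n generalizing m n
    · exact this n m hmn.symm heq.symm (by omega)
    refine ⟨next^[m] ⟨e, he⟩, n - m, by omega, ?_⟩
    rw [Function.IsPeriodicPt, Function.IsFixedPt, ← Function.iterate_add_apply,
      Nat.sub_add_cancel hlt.le]
    exact heq.symm
  have hl := Function.minimalPeriod_pos_of_mem_periodicPts he₀
  have : NeZero (Function.minimalPeriod next e₀) := ⟨hl.ne'⟩
  let f : ZMod (Function.minimalPeriod next e₀) → S := fun i => next^[i.val] e₀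
  have hf : Function.Injective f := fun i j hij => ZMod.val_injective _
    (Function.iterate_injOn_Iio_minimalPeriod (ZMod.val_lt i) (ZMod.val_lt j) hij)
  have hf_succ : ∀ i, f (i + 1) = next (f i) := by
    intro i
    have hi : i + 1 = ((i.val + 1 : ℕ) : ZMod (Function.minimalPeriod next e₀)) := by simp
    simp only [f]
    rw [hi, ZMod.val_natCast, Function.iterate_mod_minimalPeriod_eq, Function.iterate_succ_apply']
  refine ⟨_, fun i => ψ (f i), fun i => f i, ⟨hl, hψ.comp hf,
    Subtype.val_injective.comp hf, fun i => ?_⟩, fun i => (f i).2⟩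
  simpa only [hf_succ] using hnext (f i)

theorem IsOddSaturatedForest.det_ne_zero (hG : G.IsOddSaturatedForest) (σ : G.V ≃ G.E) :
    (G.squareInc σ).det ≠ 0 := by
  classical
  intro hdet
  obtain ⟨y, hy, hyA⟩ := Matrix.exists_vecMul_eq_zero_iff.2 hdet
  have hedge : ∀ e, y (G.fst e) = -y (G.snd e) := by
    intro e
    have := congrFun hyA (σ.symm e)
    rw [vecMul_squareInc, Equiv.apply_symm_apply] at this
    exact eq_neg_of_add_eq_zero_left this
  obtain ⟨v₀, hv₀⟩ := Function.ne_iff.1 hy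
  have hcomp : ∀ v, G.comp v = G.comp v₀ → y v ≠ 0 := by
    intro v hv h0
    have habs : |y v| = |y v₀| := rel_of_comp_eq (r := fun u v => |y u| = |y v|)
      ⟨fun _ => rfl, Eq.symm, Eq.trans⟩ (fun e => by rw [hedge, abs_neg]) hv
    rw [h0, abs_zero] at habs
    exact hv₀ (abs_eq_zero.1 habs.symm)
  let S : Finset G.E := {e | G.comp (G.fst e) = G.comp v₀}
  let W : Finset G.V := {v | G.comp v = G.comp v₀}
  have hWS : W.card = S.card := by
    have := hG.1 (G.comp v₀)
    rw [Nat.card_eq_fintype_card, Nat.card_eq_fintype_card, Fintype.card_subtype,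
      Fintype.card_subtype] at this
    exact this
  have hS : S.Nonempty := by
    rw [← Finset.card_pos, ← hWS, Finset.card_pos]
    exact ⟨v₀, by simp [W]⟩
  have hsub : S.biUnion G.ends ⊆ W := by
    intro v hv
    obtain ⟨e, he, hve⟩ := Finset.mem_biUnion.1 hv
    simp only [S, Finset.mem_filter_univ] at he
    simp only [ends, Finset.mem_insert, Finset.mem_singleton] at hve
    simp only [W, Finset.mem_filter_univ]
    obtain rfl | rfl := hve
    · exact he
    · rw [← comp_fst_eq_comp_snd, he]
  obtain ⟨l, c, f, hcyc, hfS⟩ := exists_isCycle_of_card_biUnion_ends_le S hS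
    (hWS ▸ Finset.card_le_card hsub)
  have hl := hG.2 l c f hcyc
  obtain ⟨hl0, -, -, hcf⟩ := hcyc
  have : NeZero l := ⟨hl0.ne'⟩
  have halt : ∀ i, y (c (i + 1)) = -y (c i) := by
    intro i
    have := hedge (f i)
    obtain ⟨h1, h2⟩ | ⟨h1, h2⟩ := hcf i <;> rw [h1, h2] at this
    · rw [this, neg_neg]
    · exact this
  have hne : ∀ i, y (c i) ≠ 0 := by
    intro i
    have he : G.comp (G.fst (f i)) = G.comp v₀ := by simpa [S] using hfS i
    obtain ⟨h1, h2⟩ | ⟨h1, h2⟩ := hcf i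
    · exact hcomp _ (h1 ▸ he)
    · exact hcomp _ (by rw [← h2, ← comp_fst_eq_comp_snd, he])
  have hprod : ∏ i, y (c i) = -∏ i, y (c i) := by
    calc ∏ i, y (c i) = ∏ i, y (c (i + 1)) :=
          (Equiv.prod_comp (Equiv.addRight (1 : ZMod l)) fun i => y (c i)).symm
      _ = -∏ i, y (c i) := by
          simp only [halt, Finset.prod_neg, Finset.card_univ, ZMod.card, hl.neg_one_pow,
            neg_one_mul]
  have : ∏ i, y (c i) ≠ 0 := Finset.prod_ne_zero_iff.2 fun i _ => hne i
  omega

theorem single_add_single_mem_range (σ : G.V ≃ G.E) (e : G.E) :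
    Pi.single (G.fst e) 1 + Pi.single (G.snd e) 1 ∈
      LinearMap.range (G.squareInc σ).mulVecLin := by
  refine ⟨Pi.single (σ.symm e) 1, ?_⟩
  rw [Matrix.mulVecLin_apply, squareInc_mulVec_single, Equiv.apply_symm_apply]

theorem single_sub_or_add_mem_range (σ : G.V ≃ G.E) {u v : G.V} (h : G.comp u = G.comp v) :
    Pi.single u 1 - Pi.single v 1 ∈ LinearMap.range (G.squareInc σ).mulVecLin ∨
      Pi.single u 1 + Pi.single v 1 ∈ LinearMap.range (G.squareInc σ).mulVecLin := by
  set L := LinearMap.range (G.squareInc σ).mulVecLin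
  refine rel_of_comp_eq (r := fun u v => (Pi.single u 1 - Pi.single v 1 : G.V → ℤ) ∈ L ∨
    (Pi.single u 1 + Pi.single v 1 : G.V → ℤ) ∈ L) ⟨fun v => ?_, ?_, ?_⟩ (fun e => ?_) h
  · simp
  · rintro u v (h | h)
    · exact Or.inl (by simpa using L.neg_mem h)
    · exact Or.inr (by rwa [add_comm])
  · rintro u v w (h₁ | h₁) (h₂ | h₂)
    · exact Or.inl (by simpa using L.add_mem h₁ h₂)
    · exact Or.inr (by convert L.add_mem h₁ h₂ using 1; abel)
    · exact Or.inr (by convert L.sub_mem h₁ h₂ using 1; abel)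
    · exact Or.inl (by convert L.sub_mem h₁ h₂ using 1; abel)
  · exact Or.inr (single_add_single_mem_range σ e)

theorem single_add_self_mem_range (σ : G.V ≃ G.E) (h : (G.squareInc σ).det ≠ 0) (v : G.V) :
    Pi.single v 1 + Pi.single v 1 ∈ LinearMap.range (G.squareInc σ).mulVecLin := by
  classical
  by_contra hv
  set L := LinearMap.range (G.squareInc σ).mulVecLin
  have hnot : ∀ u, ¬ ((Pi.single u 1 - Pi.single v 1 : G.V → ℤ) ∈ L ∧
      (Pi.single u 1 + Pi.single v 1 : G.V → ℤ) ∈ L) := fun u hu =>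
    hv (by simpa using L.sub_mem hu.2 hu.1)
  let y : G.V → ℤ := fun u => if (Pi.single u 1 - Pi.single v 1 : G.V → ℤ) ∈ L then 1 else
    if (Pi.single u 1 + Pi.single v 1 : G.V → ℤ) ∈ L then -1 else 0
  refine h (Matrix.exists_vecMul_eq_zero_iff.1 ⟨y, fun hy => ?_, ?_⟩)
  · simpa [y] using congrFun hy v
  · ext w
    rw [vecMul_squareInc]
    have hw := single_add_single_mem_range σ (σ w)
    generalize G.fst (σ w) = a at hw
    generalize G.snd (σ w) = b at hw
    have h1 : (Pi.single a 1 - Pi.single v 1 : G.V → ℤ) ∈ L ↔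
        (Pi.single b 1 + Pi.single v 1 : G.V → ℤ) ∈ L :=
      ⟨fun h => by convert L.sub_mem hw h using 1; abel,
        fun h => by convert L.sub_mem hw h using 1; abel⟩
    have h2 : (Pi.single a 1 + Pi.single v 1 : G.V → ℤ) ∈ L ↔
        (Pi.single b 1 - Pi.single v 1 : G.V → ℤ) ∈ L :=
      ⟨fun h => by convert L.sub_mem hw h using 1; abel,
        fun h => by convert L.sub_mem hw h using 1; abel⟩
    have ha := hnot a
    simp only [y, h1, h2] at ha ⊢
    simp only [Pi.zero_apply]
    split_ifs <;> simp_all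

theorem single_sub_mem_range (σ : G.V ≃ G.E) (h : (G.squareInc σ).det ≠ 0) {u v : G.V}
    (huv : G.comp u = G.comp v) :
    Pi.single u 1 - Pi.single v 1 ∈ LinearMap.range (G.squareInc σ).mulVecLin := by
  obtain h' | h' := single_sub_or_add_mem_range σ huv
  · exact h'
  · simpa using Submodule.sub_mem _ h' (single_add_self_mem_range σ h v)

open Classical in
/-- The parities of the coordinate sums over the connected components. -/
noncomputable def parity (G : Multigraph) : (G.V → ℤ) →+ (G.Comp → ZMod 2) where
  toFun x K := ((∑ v with G.comp v = K, x v : ℤ) : ZMod 2)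
  map_zero' := by ext; simp
  map_add' x y := by ext; simp [Finset.sum_add_distrib]

theorem parity_surjective : Function.Surjective G.parity := by
  classical
  intro z
  refine ⟨fun v => if v = Quotient.out (G.comp v) then (z (G.comp v)).val else 0, ?_⟩
  ext K
  change ((∑ v with G.comp v = K, _ : ℤ) : ZMod 2) = z K
  rw [Finset.sum_eq_single (Quotient.out K)]
  · simp [comp_out]
  · intro v hv hne
    rw [Finset.mem_filter_univ] at hv
    subst hv
    rw [if_neg hne]
  · intro hK
    simp [comp_out] at hK

theorem range_mulVecLin_eq_ker_parity (σ : G.V ≃ G.E) (h : (G.squareInc σ).det ≠ 0) :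
    (LinearMap.range (G.squareInc σ).mulVecLin).toAddSubgroup = G.parity.ker := by
  classical
  have : Fintype G.Comp := Fintype.ofFinite _
  ext x
  rw [Submodule.mem_toAddSubgroup, AddMonoidHom.mem_ker]
  constructor
  · rintro ⟨z, rfl⟩
    have hz : z = ∑ v, z v • Pi.single v 1 := by
      ext; simp [Finset.sum_apply, Pi.single_apply]
    rw [hz, map_sum, map_sum]
    refine Finset.sum_eq_zero fun v _ => ?_
    rw [map_smul, map_zsmul, Matrix.mulVecLin_apply, squareInc_mulVec_single]
    suffices hp : G.parity (Pi.single (G.fst (σ v)) 1 + Pi.single (G.snd (σ v)) 1) = 0 by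
      rw [hp, smul_zero]
    have hsingle : ∀ u, G.parity (Pi.single u 1) = Pi.single (G.comp u) 1 := by
      intro u
      ext K
      change ((∑ v with G.comp v = K, _ : ℤ) : ZMod 2) = _
      simp [Pi.single_apply, eq_comm]
    rw [map_add, hsingle, hsingle, comp_fst_eq_comp_snd]
    ext K
    exact CharTwo.add_self_eq_zero _
  · intro hx
    have hdecomp : x = ∑ v, x v • (Pi.single v 1 - Pi.single (Quotient.out (G.comp v)) 1) +
        ∑ K : G.Comp, (∑ v with G.comp v = K, x v) • Pi.single (Quotient.out K) 1 := by
      have hfib : ∑ K : G.Comp, (∑ v with G.comp v = K, x v) •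
          (Pi.single (Quotient.out K) 1 : G.V → ℤ) =
          ∑ v, x v • Pi.single (Quotient.out (G.comp v)) 1 := by
        rw [← Finset.sum_fiberwise Finset.univ G.comp]
        refine Finset.sum_congr rfl fun K _ => ?_
        rw [Finset.sum_smul]
        refine Finset.sum_congr rfl fun v hv => ?_
        rw [(Finset.mem_filter.1 hv).2]
      rw [hfib, ← Finset.sum_add_distrib]
      ext u
      simp only [smul_sub, sub_add_cancel]
      simp [Finset.sum_apply, Pi.single_apply]
    rw [hdecomp]
    refine Submodule.add_mem _ (Submodule.sum_mem _ fun v _ => Submodule.smul_mem _ _ ?_)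
      (Submodule.sum_mem _ fun K _ => ?_)
    · exact single_sub_mem_range σ h (comp_out _).symm
    · have hK : ((∑ v with G.comp v = K, x v : ℤ) : ZMod 2) = 0 := congrFun hx K
      rw [ZMod.intCast_zmod_eq_zero_iff_dvd] at hK
      obtain ⟨m, hm⟩ := hK
      rw [hm, mul_comm, mul_smul]
      refine Submodule.smul_mem _ _ ?_
      rw [Nat.cast_ofNat, two_smul]
      exact single_add_self_mem_range σ h _

theorem natAbs_det_squareInc (σ : G.V ≃ G.E) (h : (G.squareInc σ).det ≠ 0) :
    (G.squareInc σ).det.natAbs = 2 ^ G.numComp := by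
  rw [Matrix.natAbs_det_eq_index_range _ h, range_mulVecLin_eq_ker_parity σ h,
    AddSubgroup.index_ker, AddMonoidHom.range_eq_top_of_surjective _ parity_surjective,
    AddSubgroup.card_top, Nat.card_fun, Nat.card_zmod, numComp]

end Multigraph

/-- If (along `Λ k = (2k+1)²π² + O(1)`) the families `B k` and `C k` agree with
`-R` resp. `-Rᵀ` up to entrywise errors `o(Λ^{-1/2})`, where `R` is the
(square, via the matching `σ`) unoriented incidence matrix of a graph `τ` with
`|V| = |E|`, then `det (C k) = ±det R + o(Λ^{-1/2})` and
`det (B k) = ±det R + o(Λ^{-1/2})`; in particular `det (C k) = ±2^{κ(τ)} + o(Λ^{-1/2})`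
when `τ` is an odd saturated forest with `κ(τ)` components, and
`det (C k) = o(Λ^{-1/2})` otherwise. -/
theorem det_incidence_perturbation (τ : Multigraph) (σ : τ.V ≃ τ.E)
    (Λ : ℕ → ℝ)
    (hΛ : (fun k => Λ k - (2 * (k:ℝ) + 1) ^ 2 * π ^ 2) =O[atTop] (fun _ => (1:ℝ)))
    (R : Matrix τ.V τ.V ℝ) (hR : R = Matrix.of fun u v => τ.incR u (σ v))
    (B C : ℕ → Matrix τ.V τ.V ℝ)
    (hB : ∀ i j, (fun k => B k i j - (-(R i j))) =o[atTop]
      fun k => (Real.sqrt (Λ k))⁻¹)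
    (hC : ∀ i j, (fun k => C k i j - (-(Rᵀ i j))) =o[atTop]
      fun k => (Real.sqrt (Λ k))⁻¹) :
    (∃ ε : ℝ, (ε = 1 ∨ ε = -1) ∧
      ((fun k => (C k).det - ε * R.det) =o[atTop] fun k => (Real.sqrt (Λ k))⁻¹) ∧
      ((fun k => (B k).det - ε * R.det) =o[atTop] fun k => (Real.sqrt (Λ k))⁻¹)) ∧
    (τ.IsOddSaturatedForest → ∃ ε : ℝ, (ε = 1 ∨ ε = -1) ∧
      ((fun k => (C k).det - ε * 2 ^ τ.numComp) =o[atTop]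
        fun k => (Real.sqrt (Λ k))⁻¹)) ∧
    (¬ τ.IsOddSaturatedForest →
      ((fun k => (C k).det) =o[atTop] fun k => (Real.sqrt (Λ k))⁻¹)) := by
  have hg := isBigO_inv_sqrt_one hΛ
  have hdetR : R.det = ((τ.squareInc σ).det : ℤ) := by
    rw [hR, ← squareInc_map_intCast]
    exact (Int.cast_det _).symm
  have hdet_neg : ∀ M : Matrix τ.V τ.V ℝ, (-M).det = (-1) ^ Fintype.card τ.V * M.det :=
    Matrix.det_neg
  set s : ℝ := (-1) ^ Fintype.card τ.V
  have hs1 : s = 1 ∨ s = -1 := neg_one_pow_eq_or ℝ _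
  have hCdet : (fun k => (C k).det - s * R.det) =o[atTop] fun k => (√(Λ k))⁻¹ := by
    rw [← R.det_transpose, ← hdet_neg]
    exact IsLittleO.det_sub hg _ _ hC
  have hBdet : (fun k => (B k).det - s * R.det) =o[atTop] fun k => (√(Λ k))⁻¹ := by
    rw [← hdet_neg]
    exact IsLittleO.det_sub hg _ _ hB
  refine ⟨⟨s, hs1, hCdet, hBdet⟩, fun hτ => ?_, fun hτ => ?_⟩
  · have hnat := natAbs_det_squareInc σ (hτ.det_ne_zero σ)
    obtain hd | hd := Int.natAbs_eq (τ.squareInc σ).det <;> rw [hnat] at hd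
    · refine ⟨s, hs1, ?_⟩
      rw [hdetR, hd] at hCdet
      simpa using hCdet
    · refine ⟨-s, hs1.symm.imp (fun h => by rw [h, neg_neg]) (fun h => by rw [h]), ?_⟩
      rw [hdetR, hd] at hCdet
      simpa using hCdet
  · have h0 : (τ.squareInc σ).det = 0 := by
      by_contra h
      exact hτ ⟨isSaturatedForest_of_det_ne_zero σ h, noEvenCycle_of_det_ne_zero σ h⟩
    simpa [hdetR, h0] using hCdet
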